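/- Let five circles in the plane be pairwise distinct and not all tangent at one point. Then the set of circles that are tangent to each of the five given circles has at most 4 elements. -/

import Mathlib

noncomputable section

/-- The Euclidean plane. -/
abbrev Plane := EuclideanSpace ℝ (Fin 2)

/-- Two circles (center, radius) are tangent: they are distinct and the distance between
centers equals the sum (external) or the absolute difference (internal) of the radii. -/
def Tangent (A B : Plane × ℝ) : Prop :=
  A ≠ B ∧ (dist A.1 B.1 = A.2 + B.2 ∨ dist A.1 B.1 = |A.2 - B.2|)

section Abstract
set_option linter.unusedSectionVars false
set_option linter.unusedSimpArgs false
variable {V : Type} [AddCommGroup V] [Module ℝ V] [FiniteDimensional ℝ V]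

structure Good (B : LinearMap.BilinForm ℝ V) : Prop where
  symm : ∀ x y, B x y = B y x
  nondeg : B.Nondegenerate
  dim : Module.finrank ℝ V = 4
  par : ∀ x y, B x x = 0 → B y y = 0 → B x y = 0 → y ≠ 0 → ∃ t : ℝ, x = t • y

variable {B : LinearMap.BilinForm ℝ V}

/-- Orthogonal independent families have total size at most 4. -/
lemma Good.card (hB : Good B) {m k : ℕ} (x : Fin m → V) (y : Fin k → V)
    (hxy : ∀ i j, B (x i) (y j) = 0) (hx : LinearIndependent ℝ x)
    (hy : LinearIndependent ℝ y) : m + k ≤ 4 := by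
  have h1 := LinearMap.BilinForm.finrank_orthogonal hB.nondeg (Submodule.span ℝ (Set.range x))
  have h2 : Submodule.span ℝ (Set.range y) ≤ B.orthogonal (Submodule.span ℝ (Set.range x)) := by
    rw [Submodule.span_le]
    rintro _ ⟨j, rfl⟩
    intro z hz
    induction hz using Submodule.span_induction with
    | mem z hz => obtain ⟨i, rfl⟩ := hz; exact hxy i j
    | zero => simp
    | add a b _ _ ha hb =>
      have ha' : B a (y j) = 0 := ha
      have hb' : B b (y j) = 0 := hb
      simp [ha', hb']
    | smul c a _ ha =>
      have ha' : B a (y j) = 0 := ha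
      simp [ha']
  have h3 := Submodule.finrank_mono h2
  have h4 := finrank_span_eq_card hx
  have h5 := finrank_span_eq_card hy
  have h6 := Submodule.finrank_le (Submodule.span ℝ (Set.range x))
  rw [hB.dim] at *
  simp only [Fintype.card_fin] at h4 h5
  omega

def PM (x : ℝ) : Prop := x = 1 ∨ x = -1

lemma PM.sq {x : ℝ} (h : PM x) : x * x = 1 := by rcases h with h | h <;> rw [h] <;> norm_num

lemma PM.of_sq {x : ℝ} (h : x * x = 1) : PM x := by
  have : (x - 1) * (x + 1) = 0 := by linarith
  rcases mul_eq_zero.1 this with h | h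
  · left; linarith
  · right; linarith

lemma PM.mul {x y : ℝ} (h : PM x) (h' : PM y) : PM (x * y) := by
  apply PM.of_sq
  have := h.sq
  have := h'.sq
  calc _ = (x * x) * (y * y) := by ring
    _ = 1 := by rw [h.sq, h'.sq]; norm_num

lemma li3 {x y z : V} : LinearIndependent ℝ ![x, y, z] ↔
    ∀ a b c : ℝ, a • x + b • y + c • z = 0 → a = 0 ∧ b = 0 ∧ c = 0 := by
  rw [Fintype.linearIndependent_iff]
  constructor
  · intro h a b c e
    have := h ![a, b, c] (by simpa [Fin.sum_univ_three] using e)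
    exact ⟨this 0, this 1, this 2⟩
  · intro h g e i
    have := h (g 0) (g 1) (g 2) (by simpa [Fin.sum_univ_three] using e)
    fin_cases i
    · exact this.1
    · exact this.2.1
    · exact this.2.2

lemma li4 {x y z w : V} : LinearIndependent ℝ ![x, y, z, w] ↔
    ∀ a b c d : ℝ, a • x + b • y + c • z + d • w = 0 → a = 0 ∧ b = 0 ∧ c = 0 ∧ d = 0 := by
  rw [Fintype.linearIndependent_iff]
  constructor
  · intro h a b c d e
    have := h ![a, b, c, d] (by simpa [Fin.sum_univ_four] using e)
    exact ⟨this 0, this 1, this 2, this 3⟩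
  · intro h g e i
    have := h (g 0) (g 1) (g 2) (g 3) (by simpa [Fin.sum_univ_four] using e)
    fin_cases i
    · exact this.1
    · exact this.2.1
    · exact this.2.2.1
    · exact this.2.2.2

lemma Good.two (hB : Good B) {p q : V} (hp : B p p = 1) (hq : B q q = 1)
    (h : p ≠ q) (h' : p ≠ -q) {a b : ℝ} (hab : a • p + b • q = 0) : a = 0 ∧ b = 0 := by
  have h1 : a + b * B p q = 0 := by
    have := congrArg (fun z => B p z) hab
    simpa [hp] using this
  have h2 : a * B p q + b = 0 := by
    have := congrArg (fun z => B q z) hab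
    simpa [hq, hB.symm q p] using this
  have h3 : (a - b) * (a + b) = 0 := by linear_combination a * h1 - b * h2
  have ha : a = 0 := by
    by_contra ha
    rcases mul_eq_zero.1 h3 with h3 | h3
    · have hb : b = a := by linarith
      rw [hb, ← smul_add] at hab
      rcases smul_eq_zero.1 hab with h4 | h4
      · exact ha h4
      · exact h' (eq_neg_of_add_eq_zero_left h4)
    · have hb : b = -a := by linarith
      rw [hb, neg_smul, ← sub_eq_add_neg, ← smul_sub] at hab
      rcases smul_eq_zero.1 hab with h4 | h4
      · exact ha h4
      · exact h (sub_eq_zero.1 h4)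
  refine ⟨ha, ?_⟩
  rw [ha] at h2; linarith

/-- A dependent triple of unit vectors. -/
lemma Good.triple (hB : Good B) {x y z : V} (hx : B x x = 1) (hy : B y y = 1) (hz : B z z = 1)
    (hxy : x ≠ y) (hxy' : x ≠ -y) (hxz : x ≠ z) (hxz' : x ≠ -z) (hyz : y ≠ z) (hyz' : y ≠ -z)
    (hd : ¬ LinearIndependent ℝ ![x, y, z])
    (w₀ : V) (hw0x : PM (B w₀ x)) (hw0y : PM (B w₀ y)) (hw0z : PM (B w₀ z)) :
    ∃ n : V, n ≠ 0 ∧ B n n = 0 ∧ B x n = 0 ∧ ∀ w, B w w = 1 → PM (B w x) → PM (B w y) →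
      PM (B w z) → ∃ s t : ℝ, PM s ∧ w = s • x + t • n := by
  rw [Fintype.not_linearIndependent_iff] at hd
  obtain ⟨g, hg, hne⟩ := hd
  simp [Fin.sum_univ_three] at hg
  generalize ha : g 0 = a at hg
  generalize hb : g 1 = b at hg
  generalize hc : g 2 = c at hg
  have hne' : ¬ (a = 0 ∧ b = 0 ∧ c = 0) := by
    rintro ⟨h1, h2, h3⟩
    obtain ⟨i, hi⟩ := hne
    fin_cases i
    · exact hi (ha.trans h1)
    · exact hi (hb.trans h2)
    · exact hi (hc.trans h3)
  have ha0 : a ≠ 0 := by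
    intro h
    have h2 : b • y + c • z = 0 := by rw [← hg, h]; module
    have := hB.two hy hz hyz hyz' h2
    exact hne' ⟨h, this⟩
  have hb0 : b ≠ 0 := by
    intro h
    have h2 : a • x + c • z = 0 := by rw [← hg, h]; module
    have := hB.two hx hz hxz hxz' h2
    exact hne' ⟨this.1, h, this.2⟩
  have key : ∀ w, PM (B w x) → PM (B w y) → PM (B w z) → B x y = B w x * B w y := by
    intro w h1 h2 h3
    have e1 : a * B w x + b * B w y + c * B w z = 0 := by
      have := congrArg (fun z => B w z) hg
      simpa using this
    have e2 : a * a + b * b + 2 * a * b * B x y = c * c := by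
      have h5 : a • x + b • y = (-c) • z := by
        rw [← sub_eq_zero, ← hg]; module
      have := congrArg (fun z => B z z) h5
      simp [hx, hy, hz, hB.symm y x] at this
      linarith
    have h4 := h1.sq
    have h5 := h2.sq
    have h6 := h3.sq
    have : 2 * a * b * (B x y - B w x * B w y) = 0 := by
      linear_combination e2 - (a * B w x + b * B w y - c * B w z) * e1 + a * a * h4 + b * b * h5
        - c * c * h6
    have := mul_eq_zero.1 this
    have h7 : 2 * a * b ≠ 0 := by positivity
    have := this.resolve_left h7
    linarith
  have hpm : PM (B x y) := by rw [key w₀ hw0x hw0y hw0z]; exact hw0x.mul hw0y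
  set e := B x y with he
  have hxn : B x (x - e • y) = 0 := by
    simp [hx, ← he, hpm.sq]
  have hnn : B (x - e • y) (x - e • y) = 0 := by
    have := hpm.sq
    simp [hx, hy, hB.symm y x, ← he, hpm.sq]
  have hn0 : x - e • y ≠ 0 := by
    intro h
    rcases hpm with h1 | h1
    · rw [h1] at h; simp at h; exact hxy (sub_eq_zero.1 h)
    · rw [h1] at h; simp at h; exact hxy' (eq_neg_of_add_eq_zero_left h)
  refine ⟨x - e • y, hn0, hnn, hxn, ?_⟩
  intro w hw h1 h2 h3
  have hwn : B w (x - e • y) = 0 := by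
    have := key w h1 h2 h3
    simp
    rw [this]
    linear_combination (-B w x) * h2.sq
  have h4 : B (w - (B w x) • x) (w - (B w x) • x) = 0 := by
    have := h1.sq
    simp [hx, hw, hB.symm x w, this]
  have h5 : B (w - (B w x) • x) (x - e • y) = 0 := by
    rw [LinearMap.map_sub₂, hwn, LinearMap.map_smul₂, hxn]; simp
  obtain ⟨t, ht⟩ := hB.par _ _ h4 hnn h5 hn0
  refine ⟨B w x, t, h1, ?_⟩
  rw [← ht]; module

/-- Configuration of five unit vectors against five unit vectors. -/
structure Pre (B : LinearMap.BilinForm ℝ V) (v w : Fin 5 → V) : Prop where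
  uv : ∀ i, B (v i) (v i) = 1
  uw : ∀ i, B (w i) (w i) = 1
  pm : ∀ i j, PM (B (v i) (w j))
  dv : ∀ i j, i ≠ j → v i ≠ v j ∧ v i ≠ -v j
  dw : ∀ i j, i ≠ j → w i ≠ w j ∧ w i ≠ -w j

lemma Pre.symm (hB : Good B) {v w : Fin 5 → V} (h : Pre B v w) : Pre B w v :=
  ⟨h.uw, h.uv, fun i j => by rw [hB.symm]; exact h.pm j i, h.dw, h.dv⟩

def Coax (B : LinearMap.BilinForm ℝ V) (v : Fin 5 → V) : Prop :=
  ∃ n : V, n ≠ 0 ∧ B n n = 0 ∧ (∀ i, B (v i) n = 0) ∧ ∀ i j, PM (B (v i) (v j))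

lemma Pre.coaxial (hB : Good B) {v w : Fin 5 → V} (h : Pre B v w) {i j k : Fin 5}
    (hij : i ≠ j) (hik : i ≠ k) (hjk : j ≠ k) (hd : ¬ LinearIndependent ℝ ![w i, w j, w k]) :
    ∃ n : V, n ≠ 0 ∧ B n n = 0 ∧ B (w i) n = 0 ∧
      ∀ l, ∃ s t : ℝ, PM s ∧ v l = s • w i + t • n := by
  obtain ⟨n, h1, h2, h3, h4⟩ := hB.triple (h.uw i) (h.uw j) (h.uw k) (h.dw i j hij).1
    (h.dw i j hij).2 (h.dw i k hik).1 (h.dw i k hik).2 (h.dw j k hjk).1 (h.dw j k hjk).2 hd (v 0)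
    (h.pm _ _) (h.pm _ _) (h.pm _ _)
  exact ⟨n, h1, h2, h3, fun l => h4 (v l) (h.uv l) (h.pm _ _) (h.pm _ _) (h.pm _ _)⟩

lemma Pre.coax (hB : Good B) {v w : Fin 5 → V} (h : Pre B v w) {i j k : Fin 5}
    (hij : i ≠ j) (hik : i ≠ k) (hjk : j ≠ k) (hd : ¬ LinearIndependent ℝ ![w i, w j, w k]) :
    Coax B v := by
  obtain ⟨n, h1, h2, h3, h4⟩ := h.coaxial hB hij hik hjk hd
  refine ⟨n, h1, h2, ?_, ?_⟩
  · intro l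
    obtain ⟨s, t, hs, e⟩ := h4 l
    rw [e]; simp [h2, h3]
  · intro l m
    obtain ⟨s, t, hs, e⟩ := h4 l
    obtain ⟨s', t', hs', e'⟩ := h4 m
    rw [e, e']; simp [h2, h3, hB.symm n (w i), h.uw i]
    exact hs.mul hs'

lemma Pre.coax' (hB : Good B) {v w : Fin 5 → V} (h : Pre B v w) {i j k : Fin 5}
    (hij : i ≠ j) (hik : i ≠ k) (hjk : j ≠ k) (hd : ¬ LinearIndependent ℝ ![v i, v j, v k]) :
    Coax B v := by
  obtain ⟨n, h1, h2, h3, h4⟩ := (h.symm hB).coaxial hB hij hik hjk hd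
  refine h.coax hB (i := 0) (j := 1) (k := 2) (by decide) (by decide) (by decide) ?_
  intro hl
  rw [li3] at hl
  obtain ⟨s0, t0, p0, e0⟩ := h4 0
  obtain ⟨s1, t1, p1, e1⟩ := h4 1
  obtain ⟨s2, t2, p2, e2⟩ := h4 2
  have q0 := p0.sq
  have q1 := p1.sq
  have q2 := p2.sq
  have h5 := hl (s0 * (s1 * t1 - s2 * t2)) (s1 * (s2 * t2 - s0 * t0)) (s2 * (s0 * t0 - s1 * t1)) (by
    rw [e0, e1, e2]
    have : (s0 * s0 * (s1 * t1 - s2 * t2) + s1 * s1 * (s2 * t2 - s0 * t0)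
       + s2 * s2 * (s0 * t0 - s1 * t1)) • v i + 
       (s0 * t0 * (s1 * t1 - s2 * t2) + s1 * t1 * (s2 * t2 - s0 * t0)
       + s2 * t2 * (s0 * t0 - s1 * t1)) • n = 0 := by
      rw [q0, q1, q2]; module
    rw [← this]; module)
  have s0n : s0 ≠ 0 := by intro h; simp [h] at q0
  have s1n : s1 ≠ 0 := by intro h; simp [h] at q1
  have h6 : s1 * t1 - s2 * t2 = 0 := (mul_eq_zero.1 h5.1).resolve_left s0n
  have h7 := hl 0 s1 (-s2) (by
    rw [e1, e2]
    have : (s1 * s1 - s2 * s2) • v i + (s1 * t1 - s2 * t2) • n = 0 := by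
      rw [q1, q2, h6]; module
    rw [← this]; module)
  exact s1n h7.2.1

lemma Good.perp3 (hB : Good B) {x y z p q : V} (h : LinearIndependent ℝ ![x, y, z])
    (h1 : B x p = 0) (h2 : B y p = 0) (h3 : B z p = 0)
    (h1' : B x q = 0) (h2' : B y q = 0) (h3' : B z q = 0) (hp : p ≠ 0) : ∃ t : ℝ, q = t • p := by
  by_contra hq
  have : LinearIndependent ℝ ![p, q] := by
    rw [LinearIndependent.pair_iff' hp]
    intro a e
    exact hq ⟨a, e.symm⟩
  have := hB.card _ _ (by
    intro i j
    fin_cases i <;> fin_cases j <;> simp [*]) h this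
  omega

lemma Good.perp4 (hB : Good B) {x y z w p : V} (h : LinearIndependent ℝ ![x, y, z, w])
    (h1 : B x p = 0) (h2 : B y p = 0) (h3 : B z p = 0) (h4 : B w p = 0) : p = 0 := by
  by_contra hp
  have : LinearIndependent ℝ ![p] := by
    rw [linearIndependent_unique_iff]; simpa using hp
  have := hB.card _ _ (by
    intro i j
    fin_cases i <;> fin_cases j <;> simp [*]) h this
  omega

lemma final_algebra {al be ga et y z : ℝ} (hal : al ≠ 0) (h1 : (4 - et) * al = 16)
    (h2 : be = al) (h3 : al + be + ga = 4)
    (hy : 4 / et + y * y * ga = 1) (hz : 4 / ga + z * z * et = 1) (het : et ≠ 0) (hga : ga ≠ 0)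
    (hyz : (2 * y + 2 * z) * (2 * y + 2 * z) = 1) : False := by
  have hy' : y * y * (ga * et) = et - 4 := by field_simp at hy; linarith
  have hz' : z * z * (ga * et) = ga - 4 := by field_simp at hz; linarith
  have e1 : ga = 4 - 2 * al := by linarith
  have e2 : et = 4 - 16 / al := by field_simp; linarith
  have h4 : 8 * (y * z) * (ga * et) = ga * et - 4 * (et - 4) - 4 * (ga - 4) := by
    linear_combination (ga * et) * hyz - 4 * hy' - 4 * hz'
  have h5 : 64 * ((et - 4) * (ga - 4)) = (ga * et - 4 * (et - 4) - 4 * (ga - 4)) ^ 2 := by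
    rw [← h4, ← hy', ← hz']; ring
  have h6 : ga * et - 4 * (et - 4) - 4 * (ga - 4) = 48 := by
    rw [e1, e2]; field_simp; ring
  have h7 : (et - 4) * (ga - 4) = 32 := by
    rw [e1, e2]; field_simp; ring
  rw [h6, h7] at h5
  norm_num at h5

lemma Good.final (hB : Good B) {a b c v p q r s t : V}
    (hli : LinearIndependent ℝ ![a, b, c])
    (ha : B a a = 1) (hb : B b b = 1) (hc : B c c = 1) (hv : B v v = 1)
    (hp : B p p = 1) (hq : B q q = 1) (hr : B r r = 1) (hs : B s s = 1) (ht : B t t = 1)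
    (hd : B (a + b + c) (a + b + c) = 1)
    (ap : B a p = 1) (aq : B a q = 1) (ar : B a r = 1) (as : B a s = 1) (at' : B a t = 1)
    (bp : B b p = 1) (bq : B b q = 1) (br : B b r = -1) (bs : B b s = -1) (bt : B b t = -1)
    (cp : B c p = -1) (cq : B c q = -1) (cr : B c r = 1) (cs : B c s = 1) (ct : B c t = -1)
    (vp : B v p = 1) (vq : B v q = -1) (vr : B v r = 1) (vs : B v s = -1) (vt : PM (B v t)) :
    False := by
  have sba := hB.symm b a
  have sca := hB.symm c a
  have scb := hB.symm c b
  have hsum : B a b + B a c + B b c = -1 := by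
    simp [ha, hb, hc, sba, sca, scb] at hd; linarith
  have hpq : p - q ≠ 0 := by
    intro h
    have : p = q := sub_eq_zero.1 h
    rw [this, vq] at vp; norm_num at vp
  have hrs : r - s = p - q := by
    obtain ⟨k, hk⟩ := hB.perp3 (p := p - q) (q := r - s) hli (by simp [*]) (by simp [*])
      (by simp [*]) (by simp [*]) (by simp [*]) (by simp [*]) hpq
    have := congrArg (fun z => B v z) hk
    simp [vp, vq, vr, vs] at this
    have : k = 1 := by linarith
    rw [hk, this, one_smul]
  -- h = p - q
  obtain ⟨h, hh⟩ : ∃ h, h = p - q := ⟨_, rfl⟩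
  rw [← hh] at hpq hrs
  have Ah : B a h = 0 := by simp [*]
  have Bh : B b h = 0 := by simp [*]
  have Ch : B c h = 0 := by simp [*]
  have Vh : B v h = 2 := by simp [hh, vp, vq]; norm_num
  obtain ⟨f, hf⟩ : ∃ f, f = p + q := ⟨_, rfl⟩
  obtain ⟨g, hg⟩ : ∃ g, g = r + s := ⟨_, rfl⟩
  have fh : B f h = 0 := by simp [hf, hh, hp, hq, hB.symm q p]
  have gh : B g h = 0 := by simp [hg, ← hrs, hr, hs, hB.symm s r]
  have ff : B f f = 4 - B h h := by simp [hf, hh, hp, hq, hB.symm q p]; ring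
  have gg : B g g = 4 - B h h := by simp [hg, ← hrs, hr, hs, hB.symm s r]; ring
  have af : B a f = 2 := by simp [hf, ap, aq]; norm_num
  have bf : B b f = 2 := by simp [hf, bp, bq]; norm_num
  have cf : B c f = -2 := by simp [hf, cp, cq]; norm_num
  have ag : B a g = 2 := by simp [hg, ar, as]; norm_num
  have bg : B b g = -2 := by simp [hg, br, bs]; norm_num
  have cg : B c g = 2 := by simp [hg, cr, cs]; norm_num
  have vf : B v f = 0 := by simp [hf, vp, vq]
  have vg : B v g = 0 := by simp [hg, vr, vs]
  clear ap aq ar as bp bq br bs cp cq cr cs hp hq hr hs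
  obtain ⟨x, hx⟩ : ∃ x, x = a + b := ⟨_, rfl⟩
  obtain ⟨y, hy⟩ : ∃ y, y = a + c := ⟨_, rfl⟩
  obtain ⟨z, hz⟩ : ∃ z, z = -(b + c) := ⟨_, rfl⟩
  have xx : B x x = 2 + 2 * B a b := by simp [hx, ha, hb, sba]; ring
  have yy : B y y = 2 + 2 * B a c := by simp [hy, ha, hc, sca]; ring
  have zz : B z z = 2 + 2 * B b c := by simp [hz, hb, hc, scb]; ring
  have xy : B x y = 0 := by simp [hx, hy, ha, hb, hc, sba, sca, scb]; linarith
  have xz : B x z = 0 := by simp [hx, hz, ha, hb, hc, sba, sca, scb]; linarith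
  have yz : B y z = 0 := by simp [hy, hz, ha, hb, hc, sba, sca, scb]; linarith
  have yx := (hB.symm y x).trans xy
  have zx := (hB.symm z x).trans xz
  have zy := (hB.symm z y).trans yz
  have xh : B x h = 0 := by simp [hx, Ah, Bh]
  have yh : B y h = 0 := by simp [hy, Ah, Ch]
  have zh : B z h = 0 := by simp [hz, Bh, Ch]
  have hxx := (hB.symm h x).trans xh
  have hyy := (hB.symm h y).trans yh
  have hzz := (hB.symm h z).trans zh
  have xf : B x f = 4 := by simp [hx, af, bf]; norm_num
  have yf : B y f = 0 := by simp [hy, af, cf]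
  have zf : B z f = 0 := by simp [hz, bf, cf]
  have xg : B x g = 0 := by simp [hx, ag, bg]
  have yg : B y g = 4 := by simp [hy, ag, cg]; norm_num
  have zg : B z g = 0 := by simp [hz, bg, cg]
  have xt : B x t = 0 := by simp [hx, at', bt]
  have yt : B y t = 0 := by simp [hy, at', ct]
  have zt : B z t = 2 := by simp [hz, bt, ct]; norm_num
  have hli' : LinearIndependent ℝ ![x, y, z] := by
    rw [li3] at hli ⊢
    intro k l m e
    have := hli (k + l) (k - m) (l - m) (by rw [← e, hx, hy, hz]; module)
    refine ⟨?_, ?_, ?_⟩ <;> linarith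
  clear hx hy hz ha hb hc hd af bf cf ag bg cg Ah Bh Ch at' bt ct hli hf hg hh hrs
  have hsum' : B x x + B y y + B z z = 4 := by rw [xx, yy, zz]; linarith
  clear xx yy zz hsum
  have xn : B x x ≠ 0 := by
    intro h0
    obtain ⟨k, hk⟩ := hB.perp3 (p := h) (q := x) hli' xh yh zh h0 yx zx hpq
    have := hxx
    rw [hk] at xf
    simp [hB.symm h f, fh] at xf
  have yn : B y y ≠ 0 := by
    intro h0
    obtain ⟨k, hk⟩ := hB.perp3 (p := h) (q := y) hli' xh yh zh xy h0 zy hpq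
    rw [hk] at yg
    simp [hB.symm h g, gh] at yg
  obtain ⟨k, hk⟩ := hB.perp3 (p := h) (q := f - (4 / B x x) • x) hli' xh yh zh
    (by simp [xf, xn]) (by simp [yf, yx]) (by simp [zf, zx]) hpq
  obtain ⟨l, hl⟩ := hB.perp3 (p := h) (q := g - (4 / B y y) • y) hli' xh yh zh
    (by simp [xg, xy]) (by simp [yg, yn]) (by simp [zg, zy]) hpq
  have hk' : f = (4 / B x x) • x + k • h := by rw [← hk]; module
  have hl' : g = (4 / B y y) • y + l • h := by rw [← hl]; module
  have k0 : k * B h h = 0 := by rw [hk'] at fh; simpa [xh] using fh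
  have l0 : l * B h h = 0 := by rw [hl'] at gh; simpa [yh] using gh
  have ff' : (4 - B h h) * B x x = 16 := by
    rw [← ff, hk']; simp [xh, hxx, k0]; field_simp; norm_num
  have gg' : (4 - B h h) * B y y = 16 := by
    rw [← gg, hl']; simp [yh, hyy, l0]; field_simp; norm_num
  have hxy : B y y = B x x := by
    have : (4 - B h h) ≠ 0 := by intro h0; rw [h0] at ff'; norm_num at ff'
    exact mul_left_cancel₀ this (gg'.trans ff'.symm)
  have zn : B z z ≠ 0 := by
    intro h0
    obtain ⟨m, hm⟩ := hB.perp3 (p := h) (q := z) hli' xh yh zh xz yz h0 hpq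
    have hm0 : m ≠ 0 := by
      rintro rfl
      rw [hm] at zt; simp at zt
    rw [hm] at h0
    simp [hm0] at h0
    rw [hm] at hsum'
    simp [h0] at hsum'
    rw [h0] at ff'
    linarith
  have li : LinearIndependent ℝ ![x, y, z, h] := by
    rw [li4]
    intro i j k l e
    have e1 := congrArg (fun z => B x z) e
    have e2 := congrArg (fun w => B y w) e
    have e3 := congrArg (fun w => B z w) e
    have e4 := congrArg (fun w => B v w) e
    simp [xy, xz, xh, xn] at e1
    simp [yx, yz, yh, yn] at e2
    simp [zx, zy, zh, zn] at e3
    subst e1 e2 e3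
    simp [Vh] at e4
    simp [e4]
  have hn : B h h ≠ 0 := by
    intro h0
    exact hpq (hB.perp4 li xh yh zh h0)
  have k0' : k = 0 := (mul_eq_zero.1 k0).resolve_right hn
  have l0' : l = 0 := (mul_eq_zero.1 l0).resolve_right hn
  have vx : B v x = 0 := by
    rw [hk', k0'] at vf; simpa [xn] using vf
  have vy : B v y = 0 := by
    rw [hl', l0'] at vg; simpa [yn] using vg
  have ev : v - ((2 / B h h) • h + (B v z / B z z) • z) = 0 := by
    apply hB.perp4 li
    · simp [hB.symm x v, vx, xh, xz]
    · simp [hB.symm y v, vy, yh, yz]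
    · simp [hB.symm z v, zh, zn]
    · simp [hB.symm h v, Vh, hzz, hn]
  have et : t - ((2 / B z z) • z + (B h t / B h h) • h) = 0 := by
    apply hB.perp4 li
    · simp [xt, xh, xz]
    · simp [yt, yh, yz]
    · simp [zt, zh, zn]
    · simp [hzz, hn]
  have ev' := sub_eq_zero.1 ev
  have et' := sub_eq_zero.1 et
  generalize B v z / B z z = Y at ev'
  generalize B h t / B h h = Z at et'
  have n1 : 4 / B h h + Y * Y * B z z = 1 := by
    rw [← hv, ev']; simp [zh, hzz]; field_simp; norm_num
  have n2 : 4 / B z z + Z * Z * B h h = 1 := by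
    rw [← ht, et']; simp [zh, hzz]; field_simp; norm_num
  have n3 : B v t = 2 * Y + 2 * Z := by
    rw [ev', et']; simp [zh, hzz]; field_simp; ring
  exact final_algebra xn ff' hxy hsum' n1 n2 hn zn (by rw [← n3]; exact vt.sq)
lemma Good.noSame (hB : Good B) {a b c v p q r t : V}
    (hli : LinearIndependent ℝ ![a, b, c]) (hpq : p ≠ q)
    (ap : B a p = 1) (aq : B a q = 1) (ar : B a r = 1) (at' : B a t = 1)
    (bp : B b p = 1) (bq : B b q = 1) (br : B b r = -1) (bt : B b t = -1)
    (cp : B c p = -1) (cq : B c q = -1) (cr : B c r = 1) (ct : B c t = -1)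
    (vp : PM (B v p)) (vr : PM (B v r)) (vt : PM (B v t)) (h : B v p = B v q) :
    ∃ s, PM s ∧ (v = s • a ∨ v = s • b ∨ v = s • c ∨ v = s • (a + b + c)) := by
  have h4 : ¬ LinearIndependent ℝ ![a, b, c, v] := by
    intro h'
    have := hB.perp4 (p := p - q) h' (by simp [ap, aq]) (by simp [bp, bq]) (by simp [cp, cq])
      (by simp [h])
    exact hpq (sub_eq_zero.1 this)
  rw [li4] at h4
  push Not at h4
  obtain ⟨k, l, m, n, e, hne⟩ := h4
  have hn : n ≠ 0 := by
    rintro rfl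
    obtain ⟨h1, h2, h3⟩ := li3.1 hli k l m (by rw [← e]; module)
    exact hne h1 h2 h3 rfl
  obtain ⟨x, y, z, hv⟩ : ∃ x y z : ℝ, v = x • a + y • b + z • c := by
    refine ⟨-k / n, -l / n, -m / n, ?_⟩
    have : n • v = -(k • a + l • b + m • c) := by
      rw [← sub_eq_zero, ← e]; module
    have h2 : v = n⁻¹ • (n • v) := by rw [smul_smul, inv_mul_cancel₀ hn, one_smul]
    rw [h2, this]; module
  rw [hv] at vp vr vt
  simp [ap, ar, at', bp, br, bt, cp, cr, ct] at vp vr vt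
  have fin : ∀ s, PM s → ((x = s ∧ y = 0 ∧ z = 0) ∨ (x = 0 ∧ y = s ∧ z = 0) ∨
      (x = 0 ∧ y = 0 ∧ z = s) ∨ (x = s ∧ y = s ∧ z = s)) →
      ∃ s, PM s ∧ (v = s • a ∨ v = s • b ∨ v = s • c ∨ v = s • (a + b + c)) := by
    intro s hs h
    refine ⟨s, hs, ?_⟩
    rcases h with ⟨rfl, rfl, rfl⟩ | ⟨rfl, rfl, rfl⟩ | ⟨rfl, rfl, rfl⟩ | ⟨h1, h2, h3⟩
    · left; rw [hv]; module
    · right; left; rw [hv]; module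
    · right; right; left; rw [hv]; module
    · right; right; right; rw [hv, h1, h2, h3]; module
  rcases vp with vp | vp <;> rcases vr with vr | vr <;> rcases vt with vt | vt
  · exact fin 1 (Or.inl rfl) (Or.inl ⟨by linarith, by linarith, by linarith⟩)
  · exact fin 1 (Or.inl rfl) (Or.inr (Or.inr (Or.inr ⟨by linarith, by linarith, by linarith⟩)))
  · exact fin (-1) (Or.inr rfl) (Or.inr (Or.inr (Or.inl ⟨by linarith, by linarith, by linarith⟩)))
  · exact fin 1 (Or.inl rfl) (Or.inr (Or.inl ⟨by linarith, by linarith, by linarith⟩))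
  · exact fin (-1) (Or.inr rfl) (Or.inr (Or.inl ⟨by linarith, by linarith, by linarith⟩))
  · exact fin 1 (Or.inl rfl) (Or.inr (Or.inr (Or.inl ⟨by linarith, by linarith, by linarith⟩)))
  · exact fin (-1) (Or.inr rfl) (Or.inr (Or.inr (Or.inr ⟨by linarith, by linarith, by linarith⟩)))
  · exact fin (-1) (Or.inr rfl) (Or.inl ⟨by linarith, by linarith, by linarith⟩)

lemma Good.core (hB : Good B) {a b c d v p q r s t : V}
    (hli : LinearIndependent ℝ ![a, b, c]) (hsum : a + b + c + d = 0) (hpq : p ≠ q) (hrs : r ≠ s)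
    (ha : B a a = 1) (hb : B b b = 1) (hc : B c c = 1) (hd : B d d = 1) (hv : B v v = 1)
    (hp : B p p = 1) (hq : B q q = 1) (hr : B r r = 1) (hs : B s s = 1) (ht : B t t = 1)
    (ap : B a p = 1) (aq : B a q = 1) (ar : B a r = 1) (as : B a s = 1) (at' : B a t = 1)
    (bp : B b p = 1) (bq : B b q = 1) (br : B b r = -1) (bs : B b s = -1) (bt : B b t = -1)
    (cp : B c p = -1) (cq : B c q = -1) (cr : B c r = 1) (cs : B c s = 1) (ct : B c t = -1)
    (vp : PM (B v p)) (vq : PM (B v q)) (vr : PM (B v r)) (vs : PM (B v s)) (vt : PM (B v t))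
    (hne : ∀ x, PM x → v ≠ x • a ∧ v ≠ x • b ∧ v ≠ x • c ∧ v ≠ x • d) :
    False := by
  have hd' : d = -(a + b + c) := by rw [← sub_eq_zero, ← hsum]; module
  have hd2 : B (a + b + c) (a + b + c) = 1 := by
    rw [hd', LinearMap.map_neg₂, map_neg, neg_neg] at hd; exact hd
  have hli2 : LinearIndependent ℝ ![a, c, b] := by
    rw [li3] at hli ⊢
    intro k l m e
    obtain ⟨h1, h2, h3⟩ := hli k m l (by rw [← e]; module)
    exact ⟨h1, h3, h2⟩
  have n1 : B v p ≠ B v q := by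
    intro h
    obtain ⟨x, hx, h1⟩ := hB.noSame hli hpq ap aq ar at' bp bq br bt cp cq cr ct vp vr vt h
    have h2 := hne x hx
    have hx' : PM (-x) := by
      rcases hx with h | h
      · right; rw [h]
      · left; rw [h]; norm_num
    rcases h1 with h1 | h1 | h1 | h1
    · exact h2.1 h1
    · exact h2.2.1 h1
    · exact h2.2.2.1 h1
    · exact (hne (-x) hx').2.2.2 (by rw [h1, hd']; module)
  have n2 : B v r ≠ B v s := by
    intro h
    obtain ⟨x, hx, h1⟩ := hB.noSame hli2 hrs ar as ap at' cr cs cp ct br bs bp bt vr vp vt h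
    have h2 := hne x hx
    have hx' : PM (-x) := by
      rcases hx with h | h
      · right; rw [h]
      · left; rw [h]; norm_num
    rcases h1 with h1 | h1 | h1 | h1
    · exact h2.1 h1
    · exact h2.2.2.1 h1
    · exact h2.2.1 h1
    · exact (hne (-x) hx').2.2.2 (by rw [h1, hd']; module)
  rcases vp with vp | vp <;> rcases vq with vq | vq <;> rcases vr with vr | vr <;>
    rcases vs with vs | vs <;> first
    | exact n1 (vp.trans vq.symm)
    | exact n2 (vr.trans vs.symm)
    | exact hB.final hli ha hb hc hv hp hq hr hs ht hd2 ap aq ar as at' bp bq br bs bt cp cq cr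
        cs ct vp vq vr vs vt
    | exact hB.final hli ha hb hc hv hp hq hs hr ht hd2 ap aq as ar at' bp bq bs br bt cp cq cs
        cr ct vp vq vs vr vt
    | exact hB.final hli ha hb hc hv hq hp hr hs ht hd2 aq ap ar as at' bq bp br bs bt cq cp cr
        cs ct vq vp vr vs vt
    | exact hB.final hli ha hb hc hv hq hp hs hr ht hd2 aq ap as ar at' bq bp bs br bt cq cp cs
        cr ct vq vp vs vr vt

structure Cfg (B : LinearMap.BilinForm ℝ V) (v w : Fin 5 → V) : Prop where
  uv : ∀ i, B (v i) (v i) = 1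
  uw : ∀ i, B (w i) (w i) = 1
  pm : ∀ i j, PM (B (v i) (w j))
  iv : ∀ i j k, i ≠ j → i ≠ k → j ≠ k → LinearIndependent ℝ ![v i, v j, v k]
  iw : ∀ i j k, i ≠ j → i ≠ k → j ≠ k → LinearIndependent ℝ ![w i, w j, w k]

lemma Pre.cfg (hB : Good B) {v w : Fin 5 → V} (h : Pre B v w) (hc : ¬ Coax B v) : Cfg B v w :=
  ⟨h.uv, h.uw, h.pm, fun _ _ _ h1 h2 h3 => by_contra fun h4 => hc (h.coax' hB h1 h2 h3 h4),
    fun _ _ _ h1 h2 h3 => by_contra fun h4 => hc (h.coax hB h1 h2 h3 h4)⟩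

lemma Cfg.perm {v w : Fin 5 → V} (h : Cfg B v w) (σ : Equiv.Perm (Fin 5)) :
    Cfg B (fun i => v (σ i)) w :=
  ⟨fun i => h.uv _, h.uw, fun i j => h.pm _ _, fun i j k h1 h2 h3 =>
    h.iv _ _ _ (σ.injective.ne h1) (σ.injective.ne h2) (σ.injective.ne h3), h.iw⟩

lemma li3_sign {x y z : V} (h : LinearIndependent ℝ ![x, y, z]) {a b c : ℝ} (ha : PM a)
    (hb : PM b) (hc : PM c) : LinearIndependent ℝ ![a • x, b • y, c • z] := by
  rw [li3] at h ⊢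
  intro k l m e
  obtain ⟨h1, h2, h3⟩ := h (k * a) (l * b) (m * c) (by rw [← e]; module)
  have h4 := ha.sq
  have h5 := hb.sq
  have h6 := hc.sq
  refine ⟨?_, ?_, ?_⟩
  · linear_combination a * h1 - k * h4
  · linear_combination b * h2 - l * h5
  · linear_combination c * h3 - m * h6

lemma Cfg.sign {v w : Fin 5 → V} (h : Cfg B v w) (s s' : Fin 5 → ℝ) (hs : ∀ i, PM (s i))
    (hs' : ∀ i, PM (s' i)) : Cfg B (fun i => s i • v i) (fun i => s' i • w i) := by
  refine ⟨fun i => ?_, fun i => ?_, fun i j => ?_, fun i j k h1 h2 h3 => ?_, fun i j k h1 h2 h3 => ?_⟩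
  · have := (hs i).sq
    simp [h.uv i, this]
  · have := (hs' i).sq
    simp [h.uw i, this]
  · have := ((hs' j).mul ((hs i).mul (h.pm i j)))
    convert this using 1
    simp
  · exact li3_sign (h.iv i j k h1 h2 h3) (hs _) (hs _) (hs _)
  · exact li3_sign (h.iw i j k h1 h2 h3) (hs' _) (hs' _) (hs' _)

lemma Cfg.norm {v w : Fin 5 → V} (h : Cfg B v w) (a : Fin 5 → ℝ) (ha : ∑ i, a i • v i = 0) :
    ∃ v' w', Cfg B v' w' ∧ ∑ i, |a i| • v' i = 0 ∧ ∀ j, B (v' 0) (w' j) = 1 := by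
  let s : Fin 5 → ℝ := fun i => if a i < 0 then -1 else 1
  have hs : ∀ i, PM (s i) := by
    intro i; simp only [s]; split_ifs
    · right; rfl
    · left; rfl
  have h1 := h.sign s (fun j => s 0 * B (v 0) (w j)) hs (fun j => (hs 0).mul (h.pm 0 j))
  refine ⟨_, _, h1, ?_, ?_⟩
  · rw [← ha]
    refine Finset.sum_congr rfl fun i _ => ?_
    rw [smul_smul]
    congr 1
    simp only [s]; split_ifs with h2
    · rw [abs_of_neg h2]; ring
    · rw [abs_of_nonneg (not_lt.1 h2)]; ring
  · intro j
    have h2 := (hs 0).sq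
    have h3 := (h.pm 0 j).sq
    simp
    linear_combination (B (v 0) (w j)) * (B (v 0) (w j)) * h2 + h3

def sg (b : Bool) : ℝ := if b then 1 else -1

lemma PM.sg {x : ℝ} (h : PM x) : ∃ b, x = sg b := by
  rcases h with h | h
  · exact ⟨true, by simp [_root_.sg, h]⟩
  · exact ⟨false, by simp [_root_.sg, h]⟩

lemma cmp_aux {n : ℕ} (a : Fin n → ℝ) (ha : ∀ i, 0 < a i) (f g : Fin n → Bool)
    (hf : ∑ i, a i * sg (f i) = 0) (hg : ∑ i, a i * sg (g i) = 0) (hne : f ≠ g) :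
    ∃ k, f k = true ∧ g k = false := by
  by_contra hcon
  push Not at hcon
  have hle : ∀ i ∈ Finset.univ, a i * sg (f i) ≤ a i * sg (g i) := by
    intro i _
    have h1 := hcon i
    have h2 := ha i
    cases hfi : f i <;> cases hgi : g i <;> simp [sg]
    · linarith
    · simp [hfi, hgi] at h1
  have := (Finset.sum_eq_sum_iff_of_le hle).1 (hf.trans hg.symm)
  apply hne
  funext i
  have h1 := this i (Finset.mem_univ i)
  have h2 := mul_left_cancel₀ (ha i).ne' h1
  cases hfi : f i <;> cases hgi : g i <;> simp_all [sg] <;> linarith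

lemma cmp_aux2 {n : ℕ} (a : Fin (n + 1) → ℝ) (ha : ∀ i, 0 < a i) (f g : Fin (n + 1) → Bool)
    (hf : ∑ i, a i * sg (f i) = 0) (hg : ∑ i, a i * sg (g i) = 0) (hf0 : f 0 = true)
    (hg0 : g 0 = true) : ∃ k, f k = false ∧ g k = false := by
  by_contra hcon
  push Not at hcon
  have hpos : 0 < ∑ i, (a i * sg (f i) + a i * sg (g i)) := by
    apply Finset.sum_pos'
    · intro i _
      have h1 := hcon i
      have h2 := ha i
      cases hfi : f i <;> cases hgi : g i <;> simp [sg]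
      · simp [hfi, hgi] at h1
      · linarith
    · refine ⟨0, Finset.mem_univ _, ?_⟩
      have := ha 0
      simp [hf0, hg0, sg]; linarith
  rw [Finset.sum_add_distrib, hf, hg] at hpos
  simp at hpos

def cp3 (p q : Bool × Bool × Bool) : Bool :=
  ((p.1 && !q.1) || (p.2.1 && !q.2.1) || (p.2.2 && !q.2.2)) &&
  ((q.1 && !p.1) || (q.2.1 && !p.2.1) || (q.2.2 && !p.2.2)) &&
  ((!q.1 && !p.1) || (!q.2.1 && !p.2.1) || (!q.2.2 && !p.2.2))

def cp4 (p q : Bool × Bool × Bool × Bool) : Bool :=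
  ((p.1 && !q.1) || (p.2.1 && !q.2.1) || (p.2.2.1 && !q.2.2.1) || (p.2.2.2 && !q.2.2.2)) &&
  ((q.1 && !p.1) || (q.2.1 && !p.2.1) || (q.2.2.1 && !p.2.2.1) || (q.2.2.2 && !p.2.2.2)) &&
  ((!q.1 && !p.1) || (!q.2.1 && !p.2.1) || (!q.2.2.1 && !p.2.2.1) || (!q.2.2.2 && !p.2.2.2))

set_option synthInstance.maxHeartbeats 400000 in
set_option synthInstance.maxSize 4000 in
set_option maxRecDepth 100000 in
lemma cp4_no : ∀ p q, cp4 p q = true → ∀ r, cp4 p r = true → cp4 q r = true →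
    ∀ s, cp4 p s = true → cp4 q s = true → cp4 r s = true →
    ∀ t, cp4 p t = true → cp4 q t = true → cp4 r t = true → cp4 s t = true → False := by
  decide

set_option synthInstance.maxHeartbeats 400000 in
set_option synthInstance.maxSize 4000 in
set_option maxRecDepth 100000 in
/-- three pairwise compatible patterns are the singletons -/
lemma cp3_three : ∀ p q r, cp3 p q = true → cp3 p r = true → cp3 q r = true →
    (p = (true, false, false) ∨ p = (false, true, false) ∨ p = (false, false, true)) ∧
    (q = (true, false, false) ∨ q = (false, true, false) ∨ q = (false, false, true)) ∧
    (r = (true, false, false) ∨ r = (false, true, false) ∨ r = (false, false, true)) ∧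
    p ≠ q ∧ p ≠ r ∧ q ≠ r := by
  decide

lemma cp3_four : ∀ p q r, cp3 p q = true → cp3 p r = true → cp3 q r = true → ∀ s,
    cp3 p s = true → cp3 q s = true → cp3 r s = true → False := by
  decide

set_option synthInstance.maxHeartbeats 400000 in
set_option synthInstance.maxSize 4000 in
set_option maxRecDepth 100000 in
/-- no fibre with three elements, at most three values -/
lemma pick {α : Type} (f : Fin 5 → α) (h3 : ∀ i j k, i ≠ j → i ≠ k → j ≠ k → f i = f j → f i = f k → False)
    (h4 : ∀ i j k l, f i ≠ f j → f i ≠ f k → f i ≠ f l → f j ≠ f k → f j ≠ f l → f k ≠ f l → False) :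
    ∃ i j k l m, i ≠ j ∧ k ≠ l ∧ f i = f j ∧ f k = f l ∧ f i ≠ f k ∧ f i ≠ f m ∧ f k ≠ f m := by
  obtain ⟨i, j, hij, e⟩ : ∃ i j, i ≠ j ∧ f i = f j := by
    by_contra hcon
    push Not at hcon
    exact h4 0 1 2 3 (hcon _ _ (by decide)) (hcon _ _ (by decide)) (hcon _ _ (by decide))
      (hcon _ _ (by decide)) (hcon _ _ (by decide)) (hcon _ _ (by decide))
  obtain ⟨x, y, z, h1, h2, h5, h6, h7, h8, h9, h10, h11⟩ : ∃ x y z, i ≠ x ∧ i ≠ y ∧ i ≠ z ∧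
      j ≠ x ∧ j ≠ y ∧ j ≠ z ∧ x ≠ y ∧ x ≠ z ∧ y ≠ z := by
    clear e; revert i j; decide
  have nx : f i ≠ f x := fun h => h3 i j x hij h1 h6 e h
  have ny : f i ≠ f y := fun h => h3 i j y hij h2 h7 e h
  have nz : f i ≠ f z := fun h => h3 i j z hij h5 h8 e h
  by_cases c1 : f x = f y
  · exact ⟨i, j, x, y, z, hij, h9, e, c1, nx, nz, fun h => h3 x y z h9 h10 h11 c1 h⟩
  by_cases c2 : f x = f z
  · exact ⟨i, j, x, z, y, hij, h10, e, c2, nx, ny, c1⟩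
  by_cases c3 : f y = f z
  · exact ⟨i, j, y, z, x, hij, h11, e, c3, ny, nx, fun h => c1 h.symm⟩
  exact (h4 i x y z nx ny nz c1 c2 c3).elim

lemma Cfg.ne {v w : Fin 5 → V} (h : Cfg B v w) {i j : Fin 5} (hij : i ≠ j) (s : ℝ) :
    v i ≠ s • v j := by
  intro e
  obtain ⟨k, h1, h2⟩ : ∃ k, i ≠ k ∧ j ≠ k := by clear e; revert i j; decide
  have := (li3.1 (h.iv i j k hij h1 h2) 1 (-s) 0 (by rw [e]; module)).1
  norm_num at this

lemma Cfg.newne {v w : Fin 5 → V} (h : Cfg B v w) {i j : Fin 5} (hij : i ≠ j) (s : ℝ) :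
    w i ≠ s • w j := by
  intro e
  obtain ⟨k, h1, h2⟩ : ∃ k, i ≠ k ∧ j ≠ k := by clear e; revert i j; decide
  have := (li3.1 (h.iw i j k hij h1 h2) 1 (-s) 0 (by rw [e]; module)).1
  norm_num at this

lemma Cfg.ne' {v w : Fin 5 → V} (h : Cfg B v w) {i j : Fin 5} (hij : i ≠ j) :
    w i ≠ w j := by
  have := h.newne hij 1
  rwa [one_smul] at this

lemma Cfg.s4 (hB : Good B) {v w : Fin 5 → V} (h : Cfg B v w) (a : Fin 4 → ℝ) (ha : ∀ i, 0 < a i)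
    (hs : a 0 • v 0 + a 1 • v 1 + a 2 • v 2 + a 3 • v 3 = 0) (h0 : ∀ j, B (v 0) (w j) = 1) :
    False := by
  choose m hm using fun i j => (h.pm i j).sg
  have m0 : ∀ j, m 0 j = true := by
    intro j
    have h1 := hm 0 j
    rw [h0] at h1
    by_contra h2
    simp [sg, h2] at h1
    norm_num at h1
  have rel : ∀ j, a 0 * sg (m 0 j) + a 1 * sg (m 1 j) + a 2 * sg (m 2 j) + a 3 * sg (m 3 j) = 0 := by
    intro j
    have := congrArg (fun z => B z (w j)) hs
    simpa [hm] using this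
  let F : Fin 5 → Fin 4 → Bool := fun j => ![m 0 j, m 1 j, m 2 j, m 3 j]
  have relF : ∀ j, ∑ i, a i * sg (F j i) = 0 := by
    intro j; simpa [Fin.sum_univ_four, F] using rel j
  let f : Fin 5 → Bool × Bool × Bool := fun j => (m 1 j, m 2 j, m 3 j)
  have hcp : ∀ i j, f i ≠ f j → cp3 (f i) (f j) = true := by
    intro i j hij
    have hF : F i ≠ F j := by
      intro h
      have h1 := congrFun h 1
      have h2 := congrFun h 2
      have h3 := congrFun h 3
      simp [F] at h1 h2 h3
      exact hij (by simp [f, h1, h2, h3])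
    have c1 := cmp_aux a ha _ _ (relF i) (relF j) hF
    have c2 := cmp_aux a ha _ _ (relF j) (relF i) hF.symm
    have c3 := cmp_aux2 a ha _ _ (relF i) (relF j) (m0 i) (m0 j)
    simp [Fin.exists_fin_succ, F, m0] at c1 c2 c3
    simp only [cp3, f]
    generalize m 1 i = x1 at *
    generalize m 2 i = x2 at *
    generalize m 3 i = x3 at *
    generalize m 1 j = y1 at *
    generalize m 2 j = y2 at *
    generalize m 3 j = y3 at *
    clear hF hij
    revert x1 x2 x3 y1 y2 y3
    decide
  have h3 : ∀ i j k, i ≠ j → i ≠ k → j ≠ k → f i = f j → f i = f k → False := by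
    intro i j k hij hik hjk e1 e2
    simp [f] at e1 e2
    have eq1 : ∀ l : Fin 5, l = 0 ∨ l = 1 ∨ l = 2 → B (v l) (w i - w j) = 0 := by
      rintro l (rfl | rfl | rfl) <;> simp [hm, m0, e1]
    have eq2 : ∀ l : Fin 5, l = 0 ∨ l = 1 ∨ l = 2 → B (v l) (w i - w k) = 0 := by
      rintro l (rfl | rfl | rfl) <;> simp [hm, m0, e2]
    have hne : w i - w j ≠ 0 := sub_ne_zero.2 (h.ne' hij)
    obtain ⟨t, ht⟩ := hB.perp3 (h.iv 0 1 2 (by decide) (by decide) (by decide))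
      (eq1 0 (by simp)) (eq1 1 (by simp)) (eq1 2 (by simp))
      (eq2 0 (by simp)) (eq2 1 (by simp)) (eq2 2 (by simp)) hne
    have := li3.1 (h.iw i j k hij hik hjk) (1 - t) t (-1) (by
      rw [← sub_eq_zero] at ht; rw [← ht]; module)
    norm_num at this
  have h4 : ∀ i j k l, f i ≠ f j → f i ≠ f k → f i ≠ f l → f j ≠ f k → f j ≠ f l →
      f k ≠ f l → False := fun i j k l h1 h2 h3 h4 h5 h6 =>
    cp3_four _ _ _ (hcp _ _ h1) (hcp _ _ h2) (hcp _ _ h4) _ (hcp _ _ h3) (hcp _ _ h5) (hcp _ _ h6)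
  obtain ⟨i, j, k, l, n, hij, hkl, eij, ekl, nik, nin, nkn⟩ := pick f h3 h4
  have h5 := cp3_three _ _ _ (hcp _ _ nik) (hcp _ _ nin) (hcp _ _ nkn)
  have ri := rel i
  have rk := rel k
  have rn := rel n
  have hne : ∀ x, PM x → ∀ i : Fin 5, 4 ≠ i → v 4 ≠ x • v i := fun x _ i hi => h.ne hi x
  obtain ⟨hi, hk, hn, -⟩ := h5
  -- all coefficients agree
  have hall : a 1 = a 0 ∧ a 2 = a 0 ∧ a 3 = a 0 := by
    rcases hi with hi | hi | hi <;> rcases hk with hk | hk | hk <;> rcases hn with hn | hn | hn <;>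
      first
      | exact absurd (hi.trans hk.symm) nik
      | exact absurd (hi.trans hn.symm) nin
      | exact absurd (hk.trans hn.symm) nkn
      | (simp only [f, Prod.mk.injEq] at hi hk hn
         rw [hi.1, hi.2.1, hi.2.2, m0] at ri
         rw [hk.1, hk.2.1, hk.2.2, m0] at rk
         rw [hn.1, hn.2.1, hn.2.2, m0] at rn
         simp [sg] at ri rk rn
         refine ⟨?_, ?_, ?_⟩ <;> linarith)
  have hsum : v 0 + v 1 + v 2 + v 3 = 0 := by
    rw [hall.1, hall.2.1, hall.2.2, ← smul_add, ← smul_add, ← smul_add] at hs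
    exact (smul_eq_zero.1 hs).resolve_left (ha 0).ne'
  have S : ∀ (b c d : Fin 5) , 0 ≠ b → 0 ≠ c → 4 ≠ b → 4 ≠ c → 4 ≠ d → b ≠ c → 
      v 0 + v b + v c + v d = 0 →
      (∀ x, (x = i ∨ x = j) → m b x = true ∧ m c x = false) →
      (∀ x, (x = k ∨ x = l) → m b x = false ∧ m c x = true) →
      (m b n = false ∧ m c n = false) → False := by
    intro b c d b0 c0 b4 c4 d4 bc hs' hp hr ht
    refine hB.core (a := v 0) (b := v b) (c := v c) (d := v d) (v := v 4) (p := w i) (q := w j)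
      (r := w k) (s := w l) (t := w n) (h.iv _ _ _ b0 c0 bc) hs' (h.ne' hij) (h.ne' hkl)
      (h.uv _) (h.uv _) (h.uv _) (h.uv _) (h.uv _) (h.uw _) (h.uw _) (h.uw _) (h.uw _) (h.uw _)
      (h0 _) (h0 _) (h0 _) (h0 _) (h0 _) ?_ ?_ ?_ ?_ ?_ ?_ ?_ ?_ ?_ ?_ 
      (h.pm _ _) (h.pm _ _) (h.pm _ _) (h.pm _ _) (h.pm _ _)
      (fun x hx => ⟨hne x hx _ (by decide), hne x hx _ b4, hne x hx _ c4, hne x hx _ d4⟩)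
    · rw [hm, (hp i (by simp)).1]; simp [sg]
    · rw [hm, (hp j (by simp)).1]; simp [sg]
    · rw [hm, (hr k (by simp)).1]; simp [sg]
    · rw [hm, (hr l (by simp)).1]; simp [sg]
    · rw [hm, ht.1]; simp [sg]
    · rw [hm, (hp i (by simp)).2]; simp [sg]
    · rw [hm, (hp j (by simp)).2]; simp [sg]
    · rw [hm, (hr k (by simp)).2]; simp [sg]
    · rw [hm, (hr l (by simp)).2]; simp [sg]
    · rw [hm, ht.2]; simp [sg]
  rcases hi with hi | hi | hi <;> rcases hk with hk | hk | hk <;> rcases hn with hn | hn | hn <;>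
    first
    | exact absurd (hi.trans hk.symm) nik
    | exact absurd (hi.trans hn.symm) nin
    | exact absurd (hk.trans hn.symm) nkn
    | skip
  all_goals
    have hj := eij.symm.trans hi
    have hl := ekl.symm.trans hk
    simp only [f, Prod.mk.injEq] at hi hj hk hl hn
  · exact S 1 2 3 (by decide) (by decide) (by decide) (by decide) (by decide) (by decide)
      (by rw [← hsum]) (by rintro x (rfl | rfl) <;> simp [*]) (by rintro x (rfl | rfl) <;> simp [*])
      (by simp [*])
  · exact S 1 3 2 (by decide) (by decide) (by decide) (by decide) (by decide) (by decide)
      (by rw [← hsum]; abel) (by rintro x (rfl | rfl) <;> simp [*]) (by rintro x (rfl | rfl) <;> simp [*])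
      (by simp [*])
  · exact S 2 1 3 (by decide) (by decide) (by decide) (by decide) (by decide) (by decide)
      (by rw [← hsum]; abel) (by rintro x (rfl | rfl) <;> simp [*]) (by rintro x (rfl | rfl) <;> simp [*])
      (by simp [*])
  · exact S 2 3 1 (by decide) (by decide) (by decide) (by decide) (by decide) (by decide)
      (by rw [← hsum]; abel) (by rintro x (rfl | rfl) <;> simp [*]) (by rintro x (rfl | rfl) <;> simp [*])
      (by simp [*])
  · exact S 3 1 2 (by decide) (by decide) (by decide) (by decide) (by decide) (by decide)
      (by rw [← hsum]; abel) (by rintro x (rfl | rfl) <;> simp [*]) (by rintro x (rfl | rfl) <;> simp [*])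
      (by simp [*])
  · exact S 3 2 1 (by decide) (by decide) (by decide) (by decide) (by decide) (by decide)
      (by rw [← hsum]; abel) (by rintro x (rfl | rfl) <;> simp [*]) (by rintro x (rfl | rfl) <;> simp [*])
      (by simp [*])

lemma Cfg.s4' (hB : Good B) {v w : Fin 5 → V} (h : Cfg B v w) (a : Fin 5 → ℝ) (h4 : a 4 = 0)
    (hne : a ≠ 0) (hs : ∑ i, a i • v i = 0) : False := by
  have hs0 := hs
  simp [Fin.sum_univ_five, h4] at hs0
  have z0 : a 0 ≠ 0 := by
    intro e
    have := li3.1 (h.iv 1 2 3 (by decide) (by decide) (by decide)) (a 1) (a 2) (a 3)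
      (by rw [← hs0, e]; module)
    apply hne; funext i; fin_cases i <;> simp [*]
  have z1 : a 1 ≠ 0 := by
    intro e
    have := li3.1 (h.iv 0 2 3 (by decide) (by decide) (by decide)) (a 0) (a 2) (a 3)
      (by rw [← hs0, e]; module)
    exact z0 this.1
  have z2 : a 2 ≠ 0 := by
    intro e
    have := li3.1 (h.iv 0 1 3 (by decide) (by decide) (by decide)) (a 0) (a 1) (a 3)
      (by rw [← hs0, e]; module)
    exact z0 this.1
  have z3 : a 3 ≠ 0 := by
    intro e
    have := li3.1 (h.iv 0 1 2 (by decide) (by decide) (by decide)) (a 0) (a 1) (a 2)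
      (by rw [← hs0, e]; module)
    exact z0 this.1
  obtain ⟨v', w', h', hs', h0⟩ := h.norm a hs
  refine h'.s4 hB ![|a 0|, |a 1|, |a 2|, |a 3|] ?_ ?_ h0
  · intro i; fin_cases i <;> simp [*]
  · simpa [Fin.sum_univ_five, h4] using hs'

lemma Cfg.s5 (hB : Good B) {v w : Fin 5 → V} (h : Cfg B v w) (a : Fin 5 → ℝ) (ha : ∀ i, 0 < a i)
    (hs : ∑ i, a i • v i = 0) (h0 : ∀ j, B (v 0) (w j) = 1) : False := by
  choose m hm using fun i j => (h.pm i j).sg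
  have m0 : ∀ j, m 0 j = true := by
    intro j
    have h1 := hm 0 j
    rw [h0] at h1
    by_contra h2
    simp [sg, h2] at h1
    norm_num at h1
  let F : Fin 5 → Fin 5 → Bool := fun j i => m i j
  have relF : ∀ j, ∑ i, a i * sg (F j i) = 0 := by
    intro j
    have := congrArg (fun z => B z (w j)) hs
    simpa [hm] using this
  let f : Fin 5 → Bool × Bool × Bool × Bool := fun j => (m 1 j, m 2 j, m 3 j, m 4 j)
  have hcp : ∀ i j, i ≠ j → cp4 (f i) (f j) = true := by
    intro i j hij
    have hF : F i ≠ F j := by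
      intro e
      have hd : ¬ LinearIndependent ℝ ![v 0, v 1, v 2, v 3] := by
        intro hl
        have e' : ∀ k, B (v k) (w i - w j) = 0 := by
          intro k
          have : m k i = m k j := congrFun e k
          simp [hm, this]
        exact h.ne' hij (sub_eq_zero.1 (hB.perp4 hl (e' 0) (e' 1) (e' 2) (e' 3)))
      rw [li4] at hd
      push Not at hd
      obtain ⟨x, y, z, t, e1, e2⟩ := hd
      refine h.s4' hB ![x, y, z, t, 0] rfl ?_ (by simpa [Fin.sum_univ_five] using e1)
      intro e3
      exact e2 (congrFun e3 0) (congrFun e3 1) (congrFun e3 2) (congrFun e3 3)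
    have c1 := cmp_aux a ha _ _ (relF i) (relF j) hF
    have c2 := cmp_aux a ha _ _ (relF j) (relF i) hF.symm
    have c3 := cmp_aux2 a ha _ _ (relF i) (relF j) (m0 i) (m0 j)
    simp [Fin.exists_fin_succ, F, m0] at c1 c2 c3
    simp only [cp4, f]
    have q1 : m (Fin.succ 2) = m 3 := rfl
    have q2 : m (Fin.succ (Fin.succ 1)) = m 3 := rfl
    have q3 : m (Fin.succ (Fin.succ (Fin.succ 0))) = m 3 := rfl
    generalize m 1 i = x1 at *
    generalize m 2 i = x2 at *
    generalize m 3 i = x3 at *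
    generalize m 4 i = x4 at *
    generalize m 1 j = y1 at *
    generalize m 2 j = y2 at *
    generalize m 3 j = y3 at *
    generalize m 4 j = y4 at *
    clear hF hij q1 q2 q3
    simp
    grind
  exact cp4_no (f 0) (f 1) (hcp _ _ (by decide)) (f 2) (hcp _ _ (by decide)) (hcp _ _ (by decide))
    (f 3) (hcp _ _ (by decide)) (hcp _ _ (by decide)) (hcp _ _ (by decide))
    (f 4) (hcp _ _ (by decide)) (hcp _ _ (by decide)) (hcp _ _ (by decide)) (hcp _ _ (by decide))

lemma Cfg.false (hB : Good B) {v w : Fin 5 → V} (h : Cfg B v w) : False := by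
  have hd : ¬ LinearIndependent ℝ v := by
    intro hl
    have := hl.fintype_card_le_finrank
    rw [hB.dim] at this
    simp at this
  rw [Fintype.not_linearIndependent_iff] at hd
  obtain ⟨a, hs, hne⟩ := hd
  by_cases hz : ∃ k, a k = 0
  · obtain ⟨k, hk⟩ := hz
    refine (h.perm (Equiv.swap k 4)).s4' hB (fun i => a (Equiv.swap k 4 i)) (by simp [hk]) ?_ ?_
    · intro e
      obtain ⟨i, hi⟩ := hne
      have := congrFun e (Equiv.swap k 4 i)
      simp at this
      exact hi this
    · rw [← hs]
      exact Equiv.sum_comp (Equiv.swap k 4) (fun i => a i • v i)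
  · push Not at hz
    obtain ⟨v', w', h', hs', h0⟩ := h.norm a hs
    exact h'.s5 hB _ (fun i => abs_pos.2 (hz i)) hs' h0

theorem Pre.main (hB : Good B) {v w : Fin 5 → V} (h : Pre B v w) : Coax B v :=
  by_contra fun hc => (h.cfg hB hc).false hB
end Abstract

section Concrete

def LB : LinearMap.BilinForm ℝ (Fin 4 → ℝ) :=
  LinearMap.mk₂ ℝ (fun x y => x 0 * y 0 + x 1 * y 1 - (x 2 * y 3 + x 3 * y 2) / 2)
    (by intros; simp; ring) (by intros; simp; ring) (by intros; simp; ring) (by intros; simp; ring)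

lemma LB_apply (x y : Fin 4 → ℝ) :
    LB x y = x 0 * y 0 + x 1 * y 1 - (x 2 * y 3 + x 3 * y 2) / 2 := rfl

lemma LB_good : Good LB := by
  have hsymm : ∀ x y, LB x y = LB y x := by intro x y; simp only [LB_apply]; ring
  have hz : ∀ x, (∀ y, LB x y = 0) → x = 0 := by
    intro x hx
    have h0 := hx ![1, 0, 0, 0]
    have h1 := hx ![0, 1, 0, 0]
    have h2 := hx ![0, 0, 1, 0]
    have h3 := hx ![0, 0, 0, 1]
    simp [LB_apply] at h0 h1 h2 h3
    funext i; fin_cases i <;> simp [*]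
  refine ⟨hsymm, ?_, by simp, ?_⟩
  · refine ⟨hz, fun x hx => hz x fun y => ?_⟩
    rw [hsymm]; exact hx y
  · intro x y hx hy hxy hne
    by_cases h2 : y 2 = 0
    · simp only [LB_apply, h2] at hx hy hxy
      have y0 : y 0 = 0 := mul_self_eq_zero.1 (by nlinarith [mul_self_nonneg (y 0), mul_self_nonneg (y 1)])
      have y1 : y 1 = 0 := mul_self_eq_zero.1 (by nlinarith [mul_self_nonneg (y 0), mul_self_nonneg (y 1)])
      have y3 : y 3 ≠ 0 := by
        intro h; apply hne; funext i; fin_cases i <;> simp [*]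
      simp [y0, y1, y3] at hxy
      simp [hxy] at hx
      have x0 : x 0 = 0 := mul_self_eq_zero.1 (by nlinarith [mul_self_nonneg (x 0), mul_self_nonneg (x 1)])
      have x1 : x 1 = 0 := mul_self_eq_zero.1 (by nlinarith [mul_self_nonneg (x 0), mul_self_nonneg (x 1)])
      refine ⟨x 3 / y 3, ?_⟩
      funext i; fin_cases i <;> simp [*]
    · obtain ⟨t, ht⟩ : ∃ t, t = x 2 / y 2 := ⟨_, rfl⟩
      obtain ⟨z, hz⟩ : ∃ z, z = x - t • y := ⟨_, rfl⟩
      have z2 : z 2 = 0 := by rw [hz, ht]; simp [h2]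
      have zz : LB z z = 0 := by rw [hz]; simp [hx, hy, hxy, hsymm y x]
      have zy : LB z y = 0 := by rw [hz]; simp [hy, hxy]
      simp only [LB_apply, z2] at zz zy
      have z0 : z 0 = 0 := mul_self_eq_zero.1 (by nlinarith [mul_self_nonneg (z 0), mul_self_nonneg (z 1)])
      have z1 : z 1 = 0 := mul_self_eq_zero.1 (by nlinarith [mul_self_nonneg (z 0), mul_self_nonneg (z 1)])
      simp [z0, z1, h2] at zy
      have hz0 : z = 0 := by
        funext i; fin_cases i
        · exact z0
        · exact z1
        · exact z2
        · exact zy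
      refine ⟨t, ?_⟩
      rw [hz0] at hz
      exact (sub_eq_zero.1 hz.symm)

def cv (A : Plane × ℝ) : Fin 4 → ℝ :=
  ![A.1 0 / A.2, A.1 1 / A.2, 1 / A.2, (A.1 0 ^ 2 + A.1 1 ^ 2 - A.2 ^ 2) / A.2]

lemma plane_dist_sq (p q : Plane) : dist p q ^ 2 = (p 0 - q 0) ^ 2 + (p 1 - q 1) ^ 2 := by
  rw [EuclideanSpace.dist_eq, Real.sq_sqrt (Finset.sum_nonneg fun _ _ => sq_nonneg _)]
  simp [Fin.sum_univ_two, Real.dist_eq, sq_abs]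

lemma cv_inner {A C : Plane × ℝ} (hA : 0 < A.2) (hC : 0 < C.2) :
    LB (cv A) (cv C) = (A.2 ^ 2 + C.2 ^ 2 - dist A.1 C.1 ^ 2) / (2 * A.2 * C.2) := by
  rw [plane_dist_sq, LB_apply]
  simp [cv]
  field_simp
  ring

lemma cv_self {A : Plane × ℝ} (hA : 0 < A.2) : LB (cv A) (cv A) = 1 := by
  rw [cv_inner hA hA]; simp; field_simp; ring

lemma tan_pm {A C : Plane × ℝ} (hA : 0 < A.2) (hC : 0 < C.2) (h : Tangent A C) :
    PM (LB (cv A) (cv C)) := by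
  rw [cv_inner hA hC]
  rcases h.2 with h | h
  · right; rw [h]; field_simp; ring
  · left; rw [h, sq_abs]; field_simp; ring

lemma pm_tan {A C : Plane × ℝ} (hA : 0 < A.2) (hC : 0 < C.2) (hne : A ≠ C)
    (h : PM (LB (cv A) (cv C))) : Tangent A C := by
  refine ⟨hne, ?_⟩
  rw [cv_inner hA hC] at h
  rcases h with h | h
  · right
    rw [← abs_of_nonneg (dist_nonneg (x := A.1) (y := C.1)), ← sq_eq_sq_iff_abs_eq_abs]
    field_simp at h
    linarith
  · left
    rw [← abs_of_nonneg (dist_nonneg (x := A.1) (y := C.1)), ← abs_of_pos (add_pos hA hC),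
      ← sq_eq_sq_iff_abs_eq_abs]
    field_simp at h
    linarith

lemma cv_inj {A C : Plane × ℝ} (hA : 0 < A.2) (hC : 0 < C.2) (h : cv A = cv C) : A = C := by
  have h0 := congrFun h 0
  have h1 := congrFun h 1
  have h2 := congrFun h 2
  simp [cv] at h0 h1 h2
  rw [h2] at h0 h1
  have h3 := hC.ne'
  have e0 := (div_left_inj' h3).1 h0
  have e1 := (div_left_inj' h3).1 h1
  refine Prod.ext ?_ h2
  ext i; fin_cases i
  · exact e0
  · exact e1

lemma cv_neg {A C : Plane × ℝ} (hA : 0 < A.2) (hC : 0 < C.2) : cv A ≠ -cv C := by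
  intro h
  have h2 := congrFun h 2
  simp [cv] at h2
  have := inv_pos.2 hA
  have := inv_pos.2 hC
  linarith

end Concrete

theorem apollonius_five_circles
    (c : Fin 5 → Plane) (r : Fin 5 → ℝ) (hr : ∀ i, 0 < r i)
    (hdist : ∀ i j, i ≠ j → (c i, r i) ≠ (c j, r j))
    (hnot : ¬ ∃ p : Plane, (∀ i, dist p (c i) = r i) ∧
      ∀ i j, i ≠ j → Tangent (c i, r i) (c j, r j)) :
    {d : Plane × ℝ | 0 < d.2 ∧ ∀ i, Tangent d (c i, r i)}.encard ≤ 4 := by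
  by_contra hcon
  have h5 : (5 : ℕ∞) ≤ {d : Plane × ℝ | 0 < d.2 ∧ ∀ i, Tangent d (c i, r i)}.encard := by
    have := Order.add_one_le_of_lt (not_le.1 hcon)
    norm_num at this
    exact this
  obtain ⟨t, hts, htc⟩ := Set.exists_subset_encard_eq h5
  have hfin : t.Finite := Set.finite_of_encard_eq_coe (k := 5) htc
  have hcard : hfin.toFinset.card = 5 := by
    rw [hfin.encard_eq_coe_toFinset_card] at htc
    exact_mod_cast htc
  let e := hfin.toFinset.equivFinOfCardEq hcard
  let d : Fin 5 → Plane × ℝ := fun i => (e.symm i : Plane × ℝ)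
  have hd : ∀ i, 0 < (d i).2 ∧ ∀ j, Tangent (d i) (c j, r j) := by
    intro i
    exact hts (hfin.mem_toFinset.1 (e.symm i).2)
  have hdinj : ∀ i j, i ≠ j → d i ≠ d j := by
    intro i j hij h
    exact hij (e.symm.injective (Subtype.ext h))
  have pre : Pre LB (fun i => cv (c i, r i)) (fun j => cv (d j)) := by
    refine ⟨fun i => cv_self (hr i), fun j => cv_self (hd j).1, fun i j => ?_,
      fun i j hij => ⟨fun h => hdist i j hij (cv_inj (hr i) (hr j) h), cv_neg (hr i) (hr j)⟩,
      fun i j hij => ⟨fun h => hdinj i j hij (cv_inj (hd i).1 (hd j).1 h),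
        cv_neg (hd i).1 (hd j).1⟩⟩
    rw [LB_good.symm]
    exact tan_pm (hd j).1 (hr i) ((hd j).2 i)
  obtain ⟨n, hn0, hnn, hvn, hvv⟩ := pre.main LB_good
  apply hnot
  have hn2 : n 2 ≠ 0 := by
    intro h2
    rw [LB_apply, h2] at hnn
    have n0 : n 0 = 0 := mul_self_eq_zero.1 (by nlinarith [mul_self_nonneg (n 0), mul_self_nonneg (n 1)])
    have n1 : n 1 = 0 := mul_self_eq_zero.1 (by nlinarith [mul_self_nonneg (n 0), mul_self_nonneg (n 1)])
    have := hvn 0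
    have hr0 := (hr 0).ne'
    simp [LB_apply, cv, n0, n1, h2, hr0] at this
    apply hn0; funext i; fin_cases i <;> simp [*]
  refine ⟨!₂[n 0 / n 2, n 1 / n 2], fun i => ?_, fun i j hij =>
    pm_tan (hr i) (hr j) (hdist i j hij) (hvv i j)⟩
  have hri := hr i
  rw [← abs_of_nonneg (dist_nonneg (y := c i)), ← abs_of_pos hri, ← sq_eq_sq_iff_abs_eq_abs,
    plane_dist_sq]
  have h1 := hvn i
  have hri' := hri.ne'
  rw [LB_apply] at hnn
  simp [LB_apply, cv] at h1
  simp
  field_simp at h1 ⊢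
  linear_combination hnn - n 2 * h1
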